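/- arXiv:2005.11751 — 2 statements merged into one kernel-verified Lean document; each statement's English description precedes it below -/
import Mathlib

section
/- In SG_3, with a12 = σ1², a13 = σ2σ1²σ2⁻¹, a23 = σ2², b12 = σ1τ1, b13 = σ2σ1τ1σ2⁻¹, b23 = σ2τ2, conjugation by τ1 acts as follows: τ1⁻¹·a12·τ1 = a12; τ1⁻¹·a13·τ1 = b12⁻¹·a23·b12; τ1⁻¹·a23·τ1 = b12⁻¹·a23⁻¹·a13·a23·b12; τ1⁻¹·b12·τ1 = b12; τ1⁻¹·b13·τ1 = b12⁻¹·b23·b12; τ1⁻¹·b23·τ1 = b12⁻¹·a12·b13·a12⁻¹·b12. -/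
/-- Defining relations of the singular braid group `SG₃`, as elements of the free
group on four generators `0 ↦ σ₁`, `1 ↦ σ₂`, `2 ↦ τ₁`, `3 ↦ τ₂`. -/
def sg3Rels : Set (FreeGroup (Fin 4)) :=
  {FreeGroup.of 0 * FreeGroup.of 2 * (FreeGroup.of 2 * FreeGroup.of 0)⁻¹,
   FreeGroup.of 1 * FreeGroup.of 3 * (FreeGroup.of 3 * FreeGroup.of 1)⁻¹,
   FreeGroup.of 0 * FreeGroup.of 1 * FreeGroup.of 0 *
     (FreeGroup.of 1 * FreeGroup.of 0 * FreeGroup.of 1)⁻¹,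
   FreeGroup.of 0 * FreeGroup.of 1 * FreeGroup.of 2 *
     (FreeGroup.of 3 * FreeGroup.of 0 * FreeGroup.of 1)⁻¹,
   FreeGroup.of 1 * FreeGroup.of 0 * FreeGroup.of 3 *
     (FreeGroup.of 2 * FreeGroup.of 1 * FreeGroup.of 0)⁻¹}

/-- The singular braid group on 3 strands. -/
abbrev SG3 : Type := PresentedGroup sg3Rels

def σ1 : SG3 := PresentedGroup.of 0
def σ2 : SG3 := PresentedGroup.of 1
def τ1 : SG3 := PresentedGroup.of 2
def τ2 : SG3 := PresentedGroup.of 3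

def a12 : SG3 := σ1 ^ 2
def a13 : SG3 := σ2 * σ1 ^ 2 * σ2⁻¹
def a23 : SG3 := σ2 ^ 2
def b12 : SG3 := σ1 * τ1
def b13 : SG3 := σ2 * σ1 * τ1 * σ2⁻¹
def b23 : SG3 := σ2 * τ2

theorem sg3_rel {x y : FreeGroup (Fin 4)} (h : x * y⁻¹ ∈ sg3Rels) :
    (PresentedGroup.mk sg3Rels x) = PresentedGroup.mk sg3Rels y := by
  have := PresentedGroup.one_of_mem h
  rw [map_mul, map_inv] at this
  exact mul_inv_eq_one.mp this

theorem rel_s1t1 : σ1 * τ1 = τ1 * σ1 :=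
  sg3_rel (x := FreeGroup.of 0 * FreeGroup.of 2)
    (y := FreeGroup.of 2 * FreeGroup.of 0) (by simp [sg3Rels])

theorem rel_braid : σ1 * σ2 * σ1 = σ2 * σ1 * σ2 :=
  sg3_rel (x := FreeGroup.of 0 * FreeGroup.of 1 * FreeGroup.of 0)
    (y := FreeGroup.of 1 * FreeGroup.of 0 * FreeGroup.of 1) (by simp [sg3Rels])

theorem rel_mixed : σ1 * σ2 * τ1 = τ2 * σ1 * σ2 :=
  sg3_rel (x := FreeGroup.of 0 * FreeGroup.of 1 * FreeGroup.of 2)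
    (y := FreeGroup.of 3 * FreeGroup.of 0 * FreeGroup.of 1) (by simp [sg3Rels])

/-- If `y` is the conjugate of `x` by `s`, then conjugating `x` by `t` is conjugating `y`
by `s * t`. -/
theorem conj_aux {G : Type*} [Group G] {s t x y : G} (h : s * x = y * s) :
    t⁻¹ * x * t = (s * t)⁻¹ * y * (s * t) := by
  have : y = s * x * s⁻¹ := by rw [h]; group
  rw [this]; group

theorem conj_s1s2 : σ1 * σ2 * σ1 * (σ1 * σ2)⁻¹ = σ2 := by
  rw [rel_braid]; group

theorem conj_t : σ1 * σ2 * τ1 * (σ1 * σ2)⁻¹ = τ2 := by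
  rw [rel_mixed]; group

theorem s1_a13 : σ1 * a13 = a23 * σ1 := by
  have : σ1 * a13 = (σ1 * σ2 * σ1 * (σ1 * σ2)⁻¹) ^ 2 * σ1 := by
    unfold a13; simp only [pow_two]; group
  rw [this, conj_s1s2, a23]

theorem s1_b13 : σ1 * b13 = b23 * σ1 := by
  have : σ1 * b13 =
      (σ1 * σ2 * σ1 * (σ1 * σ2)⁻¹) * (σ1 * σ2 * τ1 * (σ1 * σ2)⁻¹) * σ1 := by
    unfold b13; group
  rw [this, conj_s1s2, conj_t, b23]

theorem s1_a23 : σ1 * a23 = a23⁻¹ * a13 * a23 * σ1 := by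
  have h : σ2⁻¹ * σ1 * σ2 = σ1 * σ2 * σ1⁻¹ := by
    have e : σ1 * σ2 * σ1⁻¹ = σ2⁻¹ * (σ2 * σ1 * σ2) * σ1⁻¹ := by group
    rw [e, ← rel_braid]; group
  have e : a23⁻¹ * a13 * a23 = (σ2⁻¹ * σ1 * σ2) ^ 2 := by
    unfold a13 a23; simp only [pow_two]; group
  rw [e, h, a23]; simp only [pow_two]; group

/-- The action (by conjugation) of `τ₁` on the generators of `SP₃`. -/
theorem stmt8 :
    τ1⁻¹ * a12 * τ1 = a12 ∧
    τ1⁻¹ * a13 * τ1 = b12⁻¹ * a23 * b12 ∧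
    τ1⁻¹ * a23 * τ1 = b12⁻¹ * a23⁻¹ * a13 * a23 * b12 ∧
    τ1⁻¹ * b12 * τ1 = b12 ∧
    τ1⁻¹ * b13 * τ1 = b12⁻¹ * b23 * b12 ∧
    τ1⁻¹ * b23 * τ1 = b12⁻¹ * a12 * b13 * a12⁻¹ * b12 := by
  have h6 : σ1 * b23 = a12 * b13 * a12⁻¹ * σ1 := by
    have : b23 = σ1 * b13 * σ1⁻¹ := by rw [s1_b13]; group
    rw [this, a12]; simp only [pow_two]; group
  refine ⟨?_, conj_aux s1_a13, ?_, ?_, conj_aux s1_b13, ?_⟩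
  · have : a12 * τ1 = τ1 * a12 := by
      rw [a12, pow_two, mul_assoc, rel_s1t1, ← mul_assoc, rel_s1t1, mul_assoc]
    rw [mul_assoc, this, inv_mul_cancel_left]
  · rw [conj_aux s1_a23, b12]; simp only [mul_assoc]
  · rw [b12, mul_assoc]
    conv_lhs => rw [rel_s1t1]
    rw [mul_assoc, inv_mul_cancel_left, rel_s1t1]
  · rw [conj_aux h6, b12]; simp only [mul_assoc]
end

section
/- In SG_3, with a12 = σ1², a13 = σ2σ1²σ2⁻¹, a23 = σ2², b12 = σ1τ1, b13 = σ2σ1τ1σ2⁻¹, b23 = σ2τ2, conjugation by τ2 acts as follows: τ2⁻¹·a12·τ2 = b23⁻¹·a13·b23; τ2⁻¹·a13·τ2 = b23⁻¹·a23·a12·a23⁻¹·b23; τ2⁻¹·a23·τ2 = a23; τ2⁻¹·b12·τ2 = b23⁻¹·b13·b23; τ2⁻¹·b13·τ2 = b23⁻¹·a23·b12·a23⁻¹·b23; τ2⁻¹·b23·τ2 = b23. -/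
theorem comm_s2_t2 : σ2 * τ2 = τ2 * σ2 := by
  have h := PresentedGroup.one_of_mem (rels := sg3Rels)
    (x := FreeGroup.of 1 * FreeGroup.of 3 * (FreeGroup.of 3 * FreeGroup.of 1)⁻¹)
    (by simp [sg3Rels])
  rw [map_mul, map_inv, mul_inv_eq_one, map_mul, map_mul] at h
  exact h

/-- The action (by conjugation) of `τ₂` on the generators of `SP₃`. -/
theorem stmt9 :
    τ2⁻¹ * a12 * τ2 = b23⁻¹ * a13 * b23 ∧
    τ2⁻¹ * a13 * τ2 = b23⁻¹ * a23 * a12 * a23⁻¹ * b23 ∧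
    τ2⁻¹ * a23 * τ2 = a23 ∧
    τ2⁻¹ * b12 * τ2 = b23⁻¹ * b13 * b23 ∧
    τ2⁻¹ * b13 * τ2 = b23⁻¹ * a23 * b12 * a23⁻¹ * b23 ∧
    τ2⁻¹ * b23 * τ2 = b23 := by
  have h := comm_s2_t2
  have h' : τ2⁻¹ * σ2 * τ2 = σ2 := by rw [mul_assoc, h]; group
  refine ⟨?_, ?_, ?_, ?_, ?_, ?_⟩ <;> simp only [a12, a13, a23, b12, b13, b23]
  · group
  · group
  · calc τ2⁻¹ * σ2 ^ 2 * τ2 = (τ2⁻¹ * σ2 * τ2) ^ 2 := by rw [pow_two, pow_two]; group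
      _ = σ2 ^ 2 := by rw [h']
  · group
  · group
  · rw [← mul_assoc, h']
end
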